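/- A(25,12) ≤ 55. That is, every binary code of length 25 in which any two distinct codewords have Hamming distance at least 12 has at most 55 codewords. -/

import Mathlib

open Finset Matrix

/-- The `±1` vector of a binary word. -/
def signVec (u : Fin 25 → Bool) : Fin 25 → ℤ := fun p => if u p then 1 else -1

/-- The inner product of the `±1` vectors of two words. -/
def signInner (u v : Fin 25 → Bool) : ℤ := signVec u ⬝ᵥ signVec v

/-- The sum of the `±1` vectors of the words in a finite set. -/
def signSum (W : Finset (Fin 25 → Bool)) : Fin 25 → ℤ := ∑ w ∈ W, signVec w

/-- The words of `C` whose inner product with `u` is `k`. -/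
def nbrs (C : Finset (Fin 25 → Bool)) (u : Fin 25 → Bool) (k : ℤ) : Finset (Fin 25 → Bool) :=
  C.filter fun v => signInner u v = k

/-- Distinct words of `C` have an even Hamming distance, which is at least `12`. -/
def IsEvenCode (C : Finset (Fin 25 → Bool)) : Prop :=
  ∀ u ∈ C, ∀ v ∈ C, u ≠ v → 12 ≤ hammingDist u v ∧ Even (hammingDist u v)

theorem signVec_odd (u : Fin 25 → Bool) (p : Fin 25) : Odd (signVec u p) := by
  unfold signVec; split_ifs <;> decide

theorem signVec_mul_self (u : Fin 25 → Bool) (p : Fin 25) : signVec u p * signVec u p = 1 := by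
  unfold signVec; split_ifs <;> rfl

theorem signInner_comm (u v : Fin 25 → Bool) : signInner u v = signInner v u :=
  dotProduct_comm _ _

theorem signInner_self (u : Fin 25 → Bool) : signInner u u = 25 := by
  simp [signInner, dotProduct, signVec_mul_self]

theorem signInner_eq (u v : Fin 25 → Bool) : signInner u v = 25 - 2 * (hammingDist u v : ℤ) := by
  have h : ∀ p, signVec u p * signVec v p = 1 - 2 * (if u p ≠ v p then 1 else 0) := by
    intro p
    unfold signVec
    cases u p <;> cases v p <;> simp
  simp only [signInner, dotProduct, h, Finset.sum_sub_distrib, ← Finset.mul_sum, hammingDist,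
    Finset.sum_boole]
  simp

theorem mem_nbrs {C : Finset (Fin 25 → Bool)} {u v : Fin 25 → Bool} {k : ℤ} :
    v ∈ nbrs C u k ↔ v ∈ C ∧ signInner u v = k := by
  simp [nbrs]

theorem signVec_dotProduct_signSum (u : Fin 25 → Bool) (W : Finset (Fin 25 → Bool)) :
    signVec u ⬝ᵥ signSum W = ∑ w ∈ W, signInner u w := by
  simp [signSum, dotProduct_sum, signInner]

theorem signSum_dotProduct_signSum (V W : Finset (Fin 25 → Bool)) :
    signSum V ⬝ᵥ signSum W = ∑ v ∈ V, ∑ w ∈ W, signInner v w := by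
  simp only [← signVec_dotProduct_signSum]
  simp [signSum, sum_dotProduct]

theorem two_dvd_signSum_sub (W : Finset (Fin 25 → Bool)) (p : Fin 25) :
    (2 : ℤ) ∣ signSum W p - #W := by
  have : signSum W p - #W = ∑ w ∈ W, (signVec w p - 1) := by
    simp [signSum]
  rw [this]
  refine Finset.dvd_sum fun w _ => ?_
  obtain ⟨k, hk⟩ := signVec_odd w p
  exact ⟨k, by rw [hk]; ring⟩

theorem le_dotProduct_self_of_odd {z : Fin 25 → ℤ} (hz : ∀ p, Odd (z p)) : 25 ≤ z ⬝ᵥ z := by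
  have h : ∀ p ∈ (univ : Finset (Fin 25)), (1 : ℤ) ≤ z p * z p := by
    intro p _
    have h0 : z p ≠ 0 := by
      intro h
      have := hz p
      rw [h] at this
      exact absurd this (by decide)
    have := mul_self_pos.2 h0
    omega
  have := Finset.sum_le_sum h
  simpa [dotProduct] using this

theorem dotProduct_self_comb (a b c d e : ℤ) (f g h k l : Fin 25 → ℤ) :
    (a • f + b • g + c • h + d • k + e • l) ⬝ᵥ (a • f + b • g + c • h + d • k + e • l) =
      a ^ 2 * (f ⬝ᵥ f) + b ^ 2 * (g ⬝ᵥ g) + c ^ 2 * (h ⬝ᵥ h) + d ^ 2 * (k ⬝ᵥ k) +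
      e ^ 2 * (l ⬝ᵥ l) + 2 * (a * b * (f ⬝ᵥ g) + a * c * (f ⬝ᵥ h) + a * d * (f ⬝ᵥ k) +
      a * e * (f ⬝ᵥ l) + b * c * (g ⬝ᵥ h) + b * d * (g ⬝ᵥ k) + b * e * (g ⬝ᵥ l) +
      c * d * (h ⬝ᵥ k) + c * e * (h ⬝ᵥ l) + d * e * (k ⬝ᵥ l)) := by
  simp only [add_dotProduct, dotProduct_add, smul_dotProduct, dotProduct_smul, smul_eq_mul]
  rw [dotProduct_comm g f, dotProduct_comm h f, dotProduct_comm k f, dotProduct_comm l f,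
    dotProduct_comm h g, dotProduct_comm k g, dotProduct_comm l g, dotProduct_comm k h,
    dotProduct_comm l h, dotProduct_comm l k]
  ring

/-- Three `±1` vectors of odd length `25` cannot be pairwise too far apart. -/
theorem neg_le_signInner_add (u v w : Fin 25 → Bool) :
    -25 ≤ signInner u v + signInner u w + signInner v w := by
  have hodd : ∀ p, Odd ((1 • signVec u + 1 • signVec v + 1 • signVec w + 0 • 0 + 0 • 0 :
      Fin 25 → ℤ) p) := by
    intro p
    have h1 := signVec_odd u p
    have h2 := signVec_odd v p
    have h3 := signVec_odd w p
    simpa using (h1.add_odd h2).add_odd h3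
  have h := le_dotProduct_self_of_odd hodd
  rw [show (1 • signVec u + 1 • signVec v + 1 • signVec w + 0 • 0 + 0 • 0 : Fin 25 → ℤ) =
    (1 : ℤ) • signVec u + (1 : ℤ) • signVec v + (1 : ℤ) • signVec w + (0 : ℤ) • 0 + (0 : ℤ) • 0
    by simp, dotProduct_self_comb] at h
  have hu := signInner_self u
  have hv := signInner_self v
  have hw := signInner_self w
  unfold signInner at *
  linarith

namespace IsEvenCode

variable {C : Finset (Fin 25 → Bool)}

theorem signInner_mem (hC : IsEvenCode C) {u v : Fin 25 → Bool} (hu : u ∈ C) (hv : v ∈ C)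
    (huv : u ≠ v) : signInner u v = 1 ∨ signInner u v = -3 ∨ signInner u v = -7 ∨
      signInner u v = -11 ∨ signInner u v = -15 ∨ signInner u v = -19 ∨ signInner u v = -23 := by
  obtain ⟨h12, k, hk⟩ := hC u hu v hv huv
  have hle : hammingDist u v ≤ 25 := by simpa using hammingDist_le_card_fintype (x := u) (y := v)
  rw [signInner_eq]
  omega

theorem signInner_le_one (hC : IsEvenCode C) {u v : Fin 25 → Bool} (hu : u ∈ C) (hv : v ∈ C)
    (huv : u ≠ v) : signInner u v ≤ 1 := by
  have := hC.signInner_mem hu hv huv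
  omega

theorem mono (hC : IsEvenCode C) {W : Finset (Fin 25 → Bool)} (h : W ⊆ C) : IsEvenCode W :=
  fun u hu v hv huv => hC u (h hu) v (h hv) huv

theorem signSum_dotProduct_self_le (hC : IsEvenCode C) :
    signSum C ⬝ᵥ signSum C ≤ (#C : ℤ) ^ 2 + 24 * #C := by
  rw [signSum_dotProduct_signSum]
  have h : ∀ u ∈ C, ∑ v ∈ C, signInner u v ≤ #C + 24 := by
    intro u hu
    have h1 : ∀ v ∈ C, signInner u v ≤ 1 + if u = v then 24 else 0 := by
      intro v hv
      split_ifs with huv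
      · subst huv; simp [signInner_self]
      · simpa using hC.signInner_le_one hu hv huv
    refine (Finset.sum_le_sum h1).trans ?_
    simp [Finset.sum_add_distrib, hu]
  refine (Finset.sum_le_sum h).trans (le_of_eq ?_)
  simp
  ring

theorem signSum_dotProduct_le (hC : IsEvenCode C) {V W : Finset (Fin 25 → Bool)} (hV : V ⊆ C)
    (hW : W ⊆ C) (h : Disjoint V W) : signSum V ⬝ᵥ signSum W ≤ #V * #W := by
  rw [signSum_dotProduct_signSum]
  have h1 : ∀ v ∈ V, ∑ w ∈ W, signInner v w ≤ #W := by
    intro v hv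
    refine (Finset.sum_le_sum (g := fun _ => 1) fun w hw =>
      hC.signInner_le_one (hV hv) (hW hw) ?_).trans (by simp)
    rintro rfl
    exact Finset.disjoint_left.1 h hv hw
  refine (Finset.sum_le_sum h1).trans (le_of_eq ?_)
  simp

theorem signVec_dotProduct_le (hC : IsEvenCode C) {u : Fin 25 → Bool}
    {W : Finset (Fin 25 → Bool)} (hu : u ∈ C) (hW : W ⊆ C) (h : u ∉ W) :
    signVec u ⬝ᵥ signSum W ≤ #W := by
  rw [signVec_dotProduct_signSum]
  refine (Finset.sum_le_sum (g := fun _ => 1) fun w hw =>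
    hC.signInner_le_one hu (hW hw) ?_).trans (by simp)
  rintro rfl
  exact h hw

end IsEvenCode

theorem signVec_dotProduct_of_subset_nbrs {C W : Finset (Fin 25 → Bool)} {u : Fin 25 → Bool}
    {k : ℤ} (hW : W ⊆ nbrs C u k) : signVec u ⬝ᵥ signSum W = k * #W := by
  rw [signVec_dotProduct_signSum, Finset.sum_congr rfl fun w hw => (mem_nbrs.1 (hW hw)).2]
  simp [mul_comm]

namespace IsEvenCode

variable {C : Finset (Fin 25 → Bool)}

theorem card_nbrs_eleven_le (hC : IsEvenCode C) {u : Fin 25 → Bool} :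
    #(nbrs C u (-11)) ≤ 5 := by
  by_contra! hcard
  obtain ⟨W, hW, hW6⟩ := Finset.exists_subset_card_eq (n := 6) hcard
  have hWC : W ⊆ C := hW.trans (Finset.filter_subset _ _)
  have hodd : ∀ p, Odd (((3 : ℤ) • signVec u + (1 : ℤ) • signSum W + (0 : ℤ) • 0 + (0 : ℤ) • 0
      + (0 : ℤ) • 0) p) := by
    intro p
    obtain ⟨k, hk⟩ := signVec_odd u p
    obtain ⟨l, hl⟩ := two_dvd_signSum_sub W p
    rw [hW6] at hl
    refine ⟨3 * k + l + 4, ?_⟩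
    simp only [Pi.add_apply, Pi.smul_apply, smul_eq_mul, Pi.zero_apply]
    push_cast at hl
    linarith
  have h := le_dotProduct_self_of_odd hodd
  rw [dotProduct_self_comb] at h
  have h1 := (hC.mono hWC).signSum_dotProduct_self_le
  have h2 := signVec_dotProduct_of_subset_nbrs hW
  have h3 := signInner_self u
  unfold signInner at h3
  rw [hW6] at h1 h2
  push_cast at h1 h2
  linarith

/-- A nonnegative odd combination of `u`, a word `v` with `⟨u, v⟩ = -15`, words with inner product
`-11` with `u` or with `v`, and words with inner product `-7` with `u` has norm at least `25`. -/
theorem le_norm_comb (hC : IsEvenCode C) {u v : Fin 25 → Bool} (hu : u ∈ C) (hv : v ∈ C)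
    (huv : signInner u v = -15) {W X S : Finset (Fin 25 → Bool)} (hW : W ⊆ nbrs C u (-11))
    (hX : X ⊆ nbrs C v (-11)) (hS : S ⊆ nbrs C u (-7)) {a b c d e : ℤ} (ha : 0 ≤ a) (hb : 0 ≤ b)
    (hc : 0 ≤ c) (hd : 0 ≤ d) (he : 0 ≤ e)
    (hodd : Odd (a + b + c * #W + d * #X + e * #S)) :
    25 ≤ 25 * a ^ 2 + 25 * b ^ 2 + c ^ 2 * (#W ^ 2 + 24 * #W) + d ^ 2 * (#X ^ 2 + 24 * #X) +
      e ^ 2 * (#S ^ 2 + 24 * #S) + 2 * (a * b * (-15) + a * c * (-11 * #W) + a * d * #X +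
      a * e * (-7 * #S) + b * c * #W + b * d * (-11 * #X) + b * e * #S +
      c * d * (#W * #X) + c * e * (#W * #S) + d * e * (#X * #S)) := by
  have hWC : W ⊆ C := hW.trans (Finset.filter_subset _ _)
  have hXC : X ⊆ C := hX.trans (Finset.filter_subset _ _)
  have hSC : S ⊆ C := hS.trans (Finset.filter_subset _ _)
  have key : ∀ w, signInner u w ≤ -7 → signInner v w ≤ -11 → False := by
    intro w h1 h2
    have := neg_le_signInner_add u v w
    linarith
  have huX : u ∉ X := by
    intro h
    have := (mem_nbrs.1 (hX h)).2
    rw [signInner_comm] at this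
    omega
  have hvW : v ∉ W := by
    intro h
    have := (mem_nbrs.1 (hW h)).2
    omega
  have hvS : v ∉ S := by
    intro h
    have := (mem_nbrs.1 (hS h)).2
    omega
  have hWX : Disjoint W X := Finset.disjoint_left.2 fun w h1 h2 =>
    key w (by linarith [(mem_nbrs.1 (hW h1)).2]) (by linarith [(mem_nbrs.1 (hX h2)).2])
  have hXS : Disjoint X S := Finset.disjoint_left.2 fun w h1 h2 =>
    key w (by linarith [(mem_nbrs.1 (hS h2)).2]) (by linarith [(mem_nbrs.1 (hX h1)).2])
  have hWS : Disjoint W S := Finset.disjoint_left.2 fun w h1 h2 => by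
    linarith [(mem_nbrs.1 (hS h2)).2, (mem_nbrs.1 (hW h1)).2]
  have hz : ∀ p, Odd ((a • signVec u + b • signVec v + c • signSum W + d • signSum X
      + e • signSum S) p) := by
    intro p
    obtain ⟨k1, hk1⟩ := signVec_odd u p
    obtain ⟨k2, hk2⟩ := signVec_odd v p
    obtain ⟨k3, hk3⟩ := two_dvd_signSum_sub W p
    obtain ⟨k4, hk4⟩ := two_dvd_signSum_sub X p
    obtain ⟨k5, hk5⟩ := two_dvd_signSum_sub S p
    obtain ⟨m, hm⟩ := hodd
    refine ⟨a * k1 + b * k2 + c * k3 + d * k4 + e * k5 + m, ?_⟩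
    simp only [Pi.add_apply, Pi.smul_apply, smul_eq_mul]
    linear_combination a * hk1 + b * hk2 + c * hk3 + d * hk4 + e * hk5 + hm
  refine (le_dotProduct_self_of_odd hz).trans ?_
  rw [dotProduct_self_comb, signVec_dotProduct_of_subset_nbrs hW,
    signVec_dotProduct_of_subset_nbrs hX, signVec_dotProduct_of_subset_nbrs hS]
  have e1 : signVec u ⬝ᵥ signVec u = 25 := signInner_self u
  have e2 : signVec v ⬝ᵥ signVec v = 25 := signInner_self v
  have e3 : signVec u ⬝ᵥ signVec v = -15 := huv
  rw [e1, e2, e3]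
  have i1 := mul_le_mul_of_nonneg_left (hC.mono hWC).signSum_dotProduct_self_le (sq_nonneg c)
  have i2 := mul_le_mul_of_nonneg_left (hC.mono hXC).signSum_dotProduct_self_le (sq_nonneg d)
  have i3 := mul_le_mul_of_nonneg_left (hC.mono hSC).signSum_dotProduct_self_le (sq_nonneg e)
  have i4 := mul_le_mul_of_nonneg_left (hC.signVec_dotProduct_le hu hXC huX) (mul_nonneg ha hd)
  have i5 := mul_le_mul_of_nonneg_left (hC.signVec_dotProduct_le hv hWC hvW) (mul_nonneg hb hc)
  have i6 := mul_le_mul_of_nonneg_left (hC.signVec_dotProduct_le hv hSC hvS) (mul_nonneg hb he)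
  have i7 := mul_le_mul_of_nonneg_left (hC.signSum_dotProduct_le hWC hXC hWX) (mul_nonneg hc hd)
  have i8 := mul_le_mul_of_nonneg_left (hC.signSum_dotProduct_le hWC hSC hWS) (mul_nonneg hc he)
  have i9 := mul_le_mul_of_nonneg_left (hC.signSum_dotProduct_le hXC hSC hXS) (mul_nonneg hd he)
  linarith

section partner

variable {u v : Fin 25 → Bool}

theorem card_nbrs_eleven_le_three (hC : IsEvenCode C) (hu : u ∈ C) (hv : v ∈ C)
    (huv : signInner u v = -15) : #(nbrs C u (-11)) ≤ 3 := by
  by_contra! hcard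
  obtain ⟨W, hW, hW4⟩ := Finset.exists_subset_card_eq (n := 4) hcard
  have h := hC.le_norm_comb hu hv huv hW (Finset.empty_subset _) (Finset.empty_subset _)
    (a := 2) (b := 1) (c := 1) (d := 0) (e := 0) (by norm_num) (by norm_num) (by norm_num)
    (by norm_num) (by norm_num) (by rw [hW4]; decide)
  rw [hW4] at h
  norm_num at h

theorem card_nbrs_seven_eq_zero (hC : IsEvenCode C) (hu : u ∈ C) (hv : v ∈ C)
    (huv : signInner u v = -15) (h3 : #(nbrs C u (-11)) = 3) (h3' : #(nbrs C v (-11)) = 3) :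
    #(nbrs C u (-7)) = 0 := by
  by_contra! hcard
  obtain ⟨S, hS, hS1⟩ := Finset.exists_subset_card_eq (Nat.one_le_iff_ne_zero.2 hcard)
  have h := hC.le_norm_comb hu hv huv subset_rfl subset_rfl hS
    (a := 6) (b := 6) (c := 2) (d := 2) (e := 1) (by norm_num) (by norm_num) (by norm_num)
    (by norm_num) (by norm_num) (by rw [h3, h3', hS1]; decide)
  rw [h3, h3', hS1] at h
  norm_num at h

theorem card_nbrs_seven_le_one (hC : IsEvenCode C) (hu : u ∈ C) (hv : v ∈ C)
    (huv : signInner u v = -15) (h3 : #(nbrs C u (-11)) = 3) (h2 : #(nbrs C v (-11)) = 2) :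
    #(nbrs C u (-7)) ≤ 1 := by
  by_contra! hcard
  obtain ⟨S, hS, hS2⟩ := Finset.exists_subset_card_eq (n := 2) hcard
  have h := hC.le_norm_comb hu hv huv subset_rfl subset_rfl hS
    (a := 5) (b := 4) (c := 2) (d := 1) (e := 1) (by norm_num) (by norm_num) (by norm_num)
    (by norm_num) (by norm_num) (by rw [h3, h2, hS2]; decide)
  rw [h3, h2, hS2] at h
  norm_num at h

end partner

end IsEvenCode

/-- The amount by which the sum of `(t + 7) (t - 1)` over the inner products `t` of `u` with the
words of `C` exceeds its largest admissible average for a code of size `56`. -/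
def excess (C : Finset (Fin 25 → Bool)) (u : Fin 25 → Bool) : ℤ :=
  ∑ v ∈ C, (signInner u v ^ 2 + 6 * signInner u v - 7) - 1008

/-- The excess of `u` after an exchange between words with inner product `-15`. -/
def balancedExcess (C : Finset (Fin 25 → Bool)) (u : Fin 25 → Bool) : ℤ :=
  excess C u + 16 * ∑ v ∈ nbrs C u (-15), ((#(nbrs C v (-11)) : ℤ) - #(nbrs C u (-11)))

theorem sum_balancedExcess (C : Finset (Fin 25 → Bool)) :
    ∑ u ∈ C, balancedExcess C u = ∑ u ∈ C, excess C u := by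
  have h : ∑ u ∈ C, ∑ v ∈ nbrs C u (-15), (#(nbrs C v (-11)) : ℤ) =
      ∑ u ∈ C, ∑ v ∈ nbrs C u (-15), (#(nbrs C u (-11)) : ℤ) := by
    simp only [nbrs, Finset.sum_filter (s := C) (fun v => signInner _ v = -15)]
    rw [Finset.sum_comm]
    simp only [signInner_comm]
  simp only [balancedExcess, Finset.sum_add_distrib, ← Finset.mul_sum, Finset.sum_sub_distrib]
  rw [h]
  ring

theorem sum_sum_signInner_sq (C : Finset (Fin 25 → Bool)) :
    ∑ u ∈ C, ∑ v ∈ C, signInner u v ^ 2 =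
      ∑ p, ∑ q, (∑ u ∈ C, signVec u p * signVec u q) ^ 2 := by
  simp only [signInner, dotProduct, sq, Finset.sum_mul_sum]
  calc _ = ∑ u ∈ C, ∑ p, ∑ v ∈ C, ∑ q, signVec u p * signVec v p * (signVec u q * signVec v q) :=
        Finset.sum_congr rfl fun u _ => Finset.sum_comm
    _ = ∑ p, ∑ u ∈ C, ∑ q, ∑ v ∈ C, signVec u p * signVec v p * (signVec u q * signVec v q) := by
        rw [Finset.sum_comm]
        exact Finset.sum_congr rfl fun p _ => Finset.sum_congr rfl fun u _ => Finset.sum_comm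
    _ = _ := by
        refine Finset.sum_congr rfl fun p _ => ?_
        rw [Finset.sum_comm]
        refine Finset.sum_congr rfl fun q _ => Finset.sum_congr rfl fun u _ =>
          Finset.sum_congr rfl fun v _ => ?_
        ring

theorem le_sum_sum_signInner_sq (C : Finset (Fin 25 → Bool)) :
    25 * (#C : ℤ) ^ 2 ≤ ∑ u ∈ C, ∑ v ∈ C, signInner u v ^ 2 := by
  rw [sum_sum_signInner_sq]
  have h : ∀ p ∈ (univ : Finset (Fin 25)),
      (#C : ℤ) ^ 2 ≤ ∑ q, (∑ u ∈ C, signVec u p * signVec u q) ^ 2 := by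
    intro p _
    refine le_trans (le_of_eq ?_) (Finset.single_le_sum
      (f := fun q => (∑ u ∈ C, signVec u p * signVec u q) ^ 2)
      (fun q _ => sq_nonneg _) (Finset.mem_univ p))
    simp [signVec_mul_self]
  have := Finset.sum_le_sum h
  simpa using this

theorem le_sum_excess {C : Finset (Fin 25 → Bool)} (h56 : #C = 56) :
    6 * (signSum C ⬝ᵥ signSum C) ≤ ∑ u ∈ C, excess C u := by
  have h := le_sum_sum_signInner_sq C
  rw [signSum_dotProduct_signSum]
  simp only [excess, Finset.sum_sub_distrib, Finset.sum_add_distrib, ← Finset.mul_sum,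
    Finset.sum_const, h56, nsmul_eq_mul] at h ⊢
  push_cast at h ⊢
  linarith

namespace IsEvenCode

variable {C : Finset (Fin 25 → Bool)} {u : Fin 25 → Bool}

theorem sum_signInner (hC : IsEvenCode C) (hu : u ∈ C) (F : ℤ → ℤ) :
    ∑ v ∈ C, F (signInner u v) = F 25 + F 1 * #(nbrs C u 1) + F (-3) * #(nbrs C u (-3)) +
      F (-7) * #(nbrs C u (-7)) + F (-11) * #(nbrs C u (-11)) + F (-15) * #(nbrs C u (-15)) +
      F (-19) * #(nbrs C u (-19)) + F (-23) * #(nbrs C u (-23)) := by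
  have hcard : ∀ k, (#(nbrs C u k) : ℤ) = ∑ v ∈ C, if signInner u v = k then 1 else 0 := by
    intro k
    simp [nbrs]
  have h25 : F 25 = ∑ v ∈ C, if u = v then F 25 else 0 := by
    simp [hu]
  rw [h25]
  simp only [hcard, Finset.mul_sum, ← Finset.sum_add_distrib]
  refine Finset.sum_congr rfl fun v hv => ?_
  by_cases huv : u = v
  · subst huv
    simp [signInner_self]
  · rcases hC.signInner_mem hu hv huv with h | h | h | h | h | h | h <;> simp [h, huv]

theorem eq_of_mem_nbrs (hC : IsEvenCode C) {v w : Fin 25 → Bool} {k l : ℤ} (hkl : k + l < -26)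
    (hv : v ∈ nbrs C u k) (hw : w ∈ nbrs C u l) : v = w := by
  rw [mem_nbrs] at hv hw
  by_contra hvw
  have h1 := hC.signInner_le_one hv.1 hw.1 hvw
  have h2 := neg_le_signInner_add u v w
  omega

theorem card_nbrs_le_one (hC : IsEvenCode C) {k : ℤ} (hk : k + k < -26) : #(nbrs C u k) ≤ 1 :=
  Finset.card_le_one.2 fun _ hv _ hw => hC.eq_of_mem_nbrs hk hv hw

theorem card_nbrs_eq_zero_or (hC : IsEvenCode C) {k l : ℤ} (hne : k ≠ l) (hkl : k + l < -26) :
    #(nbrs C u k) = 0 ∨ #(nbrs C u l) = 0 := by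
  by_contra! h
  obtain ⟨v, hv⟩ := Finset.card_pos.1 (Nat.pos_of_ne_zero h.1)
  obtain ⟨w, hw⟩ := Finset.card_pos.1 (Nat.pos_of_ne_zero h.2)
  have hvw := hC.eq_of_mem_nbrs hkl hv hw
  rw [mem_nbrs] at hv hw
  rw [hvw] at hv
  exact hne (hv.2.symm.trans hw.2)

/-- The words with positive balanced excess have a large inner product with the sum of all words,
and so have, with one exception, those with balanced excess zero. -/
theorem balancedExcess_bounds (hC : IsEvenCode C) (h56 : #C = 56) (hu : u ∈ C) :
    (0 < balancedExcess C u → balancedExcess C u ≤ 4 * (signVec u ⬝ᵥ signSum C) - 64) ∧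
    (balancedExcess C u = 0 → signVec u ⬝ᵥ signSum C = 0 → #(nbrs C u (-11)) ≠ 3 ∧
      ∃ v ∈ C, #(nbrs C v (-11)) = 3) := by
  have hcard := hC.sum_signInner hu fun _ => 1
  simp only [Finset.sum_const, h56, nsmul_eq_mul] at hcard
  have hsum := hC.sum_signInner hu fun t => t
  have hexc := hC.sum_signInner hu fun t => t ^ 2 + 6 * t - 7
  rw [← signVec_dotProduct_signSum] at hsum
  have h5 := hC.card_nbrs_eleven_le (u := u)
  have c15 := hC.card_nbrs_le_one (u := u) (k := -15) (by norm_num)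
  have c19 := hC.card_nbrs_le_one (u := u) (k := -19) (by norm_num)
  have c23 := hC.card_nbrs_le_one (u := u) (k := -23) (by norm_num)
  have d1 := hC.card_nbrs_eq_zero_or (u := u) (k := -15) (l := -19) (by norm_num) (by norm_num)
  have d2 := hC.card_nbrs_eq_zero_or (u := u) (k := -15) (l := -23) (by norm_num) (by norm_num)
  have d3 := hC.card_nbrs_eq_zero_or (u := u) (k := -19) (l := -23) (by norm_num) (by norm_num)
  have d4 := hC.card_nbrs_eq_zero_or (u := u) (k := -23) (l := -7) (by norm_num) (by norm_num)
  have d5 := hC.card_nbrs_eq_zero_or (u := u) (k := -23) (l := -11) (by norm_num) (by norm_num)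
  have d6 := hC.card_nbrs_eq_zero_or (u := u) (k := -19) (l := -11) (by norm_num) (by norm_num)
  unfold balancedExcess excess
  rw [hexc, hsum]
  norm_num at hcard ⊢
  rcases (nbrs C u (-15)).eq_empty_or_nonempty with h | ⟨v, hv⟩
  · rw [h] at hcard ⊢
    simp only [Finset.card_empty, Finset.sum_empty] at hcard ⊢
    clear hsum hexc c15 d1 d2
    omega
  · have hsing : nbrs C u (-15) = {v} := Finset.eq_singleton_iff_unique_mem.2
      ⟨hv, fun w hw => hC.eq_of_mem_nbrs (by norm_num) hw hv⟩
    obtain ⟨hvC, huv⟩ := mem_nbrs.1 hv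
    have hvu : signInner v u = -15 := by rw [signInner_comm, huv]
    have b1 := hC.card_nbrs_eleven_le_three hu hvC huv
    have b2 := hC.card_nbrs_eleven_le_three hvC hu hvu
    have b3 := hC.card_nbrs_seven_eq_zero hu hvC huv
    have b4 := hC.card_nbrs_seven_le_one hu hvC huv
    rw [hsing] at hcard d1 d2 ⊢
    simp only [Finset.card_singleton, Finset.sum_singleton] at hcard d1 d2 ⊢
    clear hsum hexc c15
    refine ⟨by omega, fun h1 h2 => ⟨by omega, v, hvC, by omega⟩⟩

theorem card_ne (hC : IsEvenCode C) : #C ≠ 56 := by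
  intro h56
  have htot := le_sum_excess h56
  rw [← sum_balancedExcess] at htot
  set U := C.filter fun u => 0 < balancedExcess C u with hU
  have hUC : U ⊆ C := Finset.filter_subset _ _
  have hcc : 0 ≤ signSum C ⬝ᵥ signSum C := Finset.sum_nonneg fun p _ => mul_self_nonneg _
  have hle : ∑ u ∈ C, balancedExcess C u ≤ ∑ u ∈ U, balancedExcess C u := by
    rw [hU, Finset.sum_filter]
    refine Finset.sum_le_sum fun u _ => ?_
    split_ifs <;> omega
  have hle' : ∑ u ∈ U, balancedExcess C u ≤ 4 * (signSum U ⬝ᵥ signSum C) - 64 * #U := by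
    have : ∑ u ∈ U, (4 * (signVec u ⬝ᵥ signSum C) - 64) =
        4 * (signSum U ⬝ᵥ signSum C) - 64 * #U := by
      rw [Finset.sum_sub_distrib, ← Finset.mul_sum]
      simp [signSum, sum_dotProduct, mul_comm]
    rw [← this]
    refine Finset.sum_le_sum fun u hu => ?_
    obtain ⟨huC, hpos⟩ := Finset.mem_filter.1 hu
    exact (hC.balancedExcess_bounds h56 huC).1 hpos
  have hUU := (hC.mono hUC).signSum_dotProduct_self_le
  have hcs : (signSum U ⬝ᵥ signSum C) ^ 2 ≤
      (signSum U ⬝ᵥ signSum U) * (signSum C ⬝ᵥ signSum C) := by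
    have := Finset.sum_mul_sq_le_sq_mul_sq univ (signSum U) (signSum C)
    simpa [dotProduct, sq] using this
  have hb : (#U : ℤ) ≤ 56 := by
    exact_mod_cast (Finset.card_le_card hUC).trans h56.le
  rcases U.eq_empty_or_nonempty with hempty | hne
  · have hnonpos : ∀ u ∈ C, balancedExcess C u ≤ 0 := by
      intro u hu
      by_contra! h
      have : u ∈ U := Finset.mem_filter.2 ⟨hu, h⟩
      simp [hempty] at this
    rw [hempty, Finset.sum_empty] at hle
    have hc0 : signSum C = 0 := dotProduct_self_eq_zero.1 (by linarith)
    have hzero : ∀ u ∈ C, balancedExcess C u = 0 :=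
      (Finset.sum_eq_zero_iff_of_nonpos hnonpos).1 (by linarith)
    have hall : ∀ u ∈ C, #(nbrs C u (-11)) ≠ 3 ∧ ∃ v ∈ C, #(nbrs C v (-11)) = 3 := fun u hu =>
      (hC.balancedExcess_bounds h56 hu).2 (hzero u hu) (by simp [hc0])
    obtain ⟨u, hu⟩ : C.Nonempty := Finset.card_pos.1 (by omega)
    obtain ⟨-, v, hv, h3⟩ := hall u hu
    exact (hall v hv).1 h3
  · have hb0 : (0 : ℤ) < #U := by exact_mod_cast Finset.card_pos.2 hne
    generalize signSum U ⬝ᵥ signSum C = Y at *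
    generalize signSum C ⬝ᵥ signSum C = c at *
    generalize signSum U ⬝ᵥ signSum U = y at *
    generalize (#U : ℤ) = b at *
    have h1 : y ≤ 80 * b := by nlinarith
    have h2 : Y ^ 2 ≤ 80 * b * c := hcs.trans (mul_le_mul_of_nonneg_right h1 hcc)
    have h3 : 6 * c ≤ 4 * Y - 64 * b := by linarith
    have h4 : 6 * Y ^ 2 ≤ 80 * b * (4 * Y - 64 * b) := by nlinarith
    nlinarith [sq_nonneg (3 * Y - 80 * b), mul_pos hb0 hb0]

end IsEvenCode

/-- Replace the last letter of a word by the parity of the other letters. -/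
def parityWord (u : Fin 25 → Bool) : Fin 25 → Bool :=
  fun p => if p = 24 then decide (Odd #{q | q ≠ 24 ∧ u q = true}) else u p

theorem hammingDist_le_parityWord (u v : Fin 25 → Bool) :
    hammingDist u v ≤ hammingDist (parityWord u) (parityWord v) + 1 := by
  unfold hammingDist
  refine (Finset.card_le_card
    (t := insert 24 (univ.filter fun p => parityWord u p ≠ parityWord v p)) ?_).trans
    (Finset.card_insert_le _ _)
  intro p hp
  by_cases h : p = 24
  · simp [h]
  · simpa [parityWord, h] using hp

theorem even_card_parityWord (u : Fin 25 → Bool) : Even #{p | parityWord u p = true} := by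
  set S : Finset (Fin 25) := {q | q ≠ 24 ∧ u q = true} with hS
  have h24 : (24 : Fin 25) ∉ S := by simp [hS]
  by_cases hodd : Odd #S
  · have : ({p | parityWord u p = true} : Finset (Fin 25)) = insert 24 S := by
      ext p
      by_cases h : p = 24
      · simpa [parityWord, h, ← hS] using hodd
      · simp [parityWord, h, hS]
    rw [this, Finset.card_insert_of_notMem h24]
    exact hodd.add_one
  · have : ({p | parityWord u p = true} : Finset (Fin 25)) = S := by
      ext p
      by_cases h : p = 24
      · simpa [parityWord, h, h24, ← hS] using hodd
      · simp [parityWord, h, hS]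
    rw [this]
    exact Nat.not_odd_iff_even.1 hodd

theorem even_hammingDist {u v : Fin 25 → Bool} (hu : Even #{p | u p = true})
    (hv : Even #{p | v p = true}) : Even (hammingDist u v) := by
  have h : (hammingDist u v : ℤ) = #{p | u p = true} + #{p | v p = true} -
      2 * #{p | u p = true ∧ v p = true} := by
    simp only [hammingDist, Finset.card_filter]
    push_cast
    rw [← Finset.sum_add_distrib, Finset.mul_sum, ← Finset.sum_sub_distrib]
    refine Finset.sum_congr rfl fun p _ => ?_
    cases u p <;> cases v p <;> simp
  obtain ⟨a, ha⟩ := hu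
  obtain ⟨b, hb⟩ := hv
  rw [Nat.even_iff]
  omega

theorem even_hammingDist_parityWord (u v : Fin 25 → Bool) :
    Even (hammingDist (parityWord u) (parityWord v)) :=
  even_hammingDist (even_card_parityWord u) (even_card_parityWord v)

/-- `A(25,12) ≤ 55`: every binary code of length 25 in which any two distinct
codewords have Hamming distance at least 12 has at most 55 codewords. -/
theorem A_25_12_le_55 (C : Finset (Fin 25 → Bool))
    (hC : ∀ u ∈ C, ∀ v ∈ C, u ≠ v → 12 ≤ hammingDist u v) :
    C.card ≤ 55 := by
  by_contra! hcard
  have hdist : ∀ u ∈ C, ∀ v ∈ C, u ≠ v → 12 ≤ hammingDist (parityWord u) (parityWord v) := by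
    intro u hu v hv huv
    have h1 := hC u hu v hv huv
    have h2 := hammingDist_le_parityWord u v
    obtain ⟨k, hk⟩ := even_hammingDist_parityWord u v
    omega
  have hinj : Set.InjOn parityWord C := by
    intro u hu v hv h
    by_contra huv
    have := hdist u hu v hv huv
    rw [h, hammingDist_self] at this
    omega
  obtain ⟨D, hD, hD56⟩ := Finset.exists_subset_card_eq (n := 56) hcard
  have heven : IsEvenCode (D.image parityWord) := by
    intro u hu v hv huv
    obtain ⟨u, huD, rfl⟩ := Finset.mem_image.1 hu
    obtain ⟨v, hvD, rfl⟩ := Finset.mem_image.1 hv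
    exact ⟨hdist u (hD huD) v (hD hvD) fun h => huv (h ▸ rfl), even_hammingDist_parityWord u v⟩
  refine heven.card_ne ?_
  rw [Finset.card_image_of_injOn (hinj.mono (by exact_mod_cast hD)), hD56]
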